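/- Fix a natural number K ≥ 2 and a cost function c : ℕ × ℕ → ℝ. Define F : ℕ × ℕ → ℝ recursively by F(0,a) = c(0,a) and F(l+1,a) = min( c(l+1,a), ∑_{i=0}^{K−1} F(l, K·a+i) ). Then F(l,a) = minCost(I(l,a)) for all natural numbers l and a; that is, the bottom-up dynamic program computes, for every hierarchical grid, the minimum cost over all hierarchical partitions of that grid. -/

import Mathlib

/-- The `K`-adic interval of level `l` and index `a`:
`I(l,a) = {x : ℕ | a·K^l ≤ x < (a+1)·K^l}`. -/
def kInt (K l a : ℕ) : Finset ℕ := Finset.Ico (a * K ^ l) ((a + 1) * K ^ l)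

/-- `P` is a hierarchical partition of the finite set `R`: the K-adic intervals
indexed by the pairs in `P` are pairwise disjoint and their union is `R`. -/
def IsHierPart (K : ℕ) (P : Finset (ℕ × ℕ)) (R : Finset ℕ) : Prop :=
  (∀ p ∈ P, ∀ q ∈ P, p ≠ q → Disjoint (kInt K p.1 p.2) (kInt K q.1 q.2)) ∧
  P.biUnion (fun p => kInt K p.1 p.2) = R

/-- The cost of a hierarchical partition. -/
def cost (c : ℕ × ℕ → ℝ) (P : Finset (ℕ × ℕ)) : ℝ := ∑ p ∈ P, c p

/-- The minimum cost over all hierarchical partitions of `R` (as an infimum of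
the set of attainable costs; for finite `R` this set is finite and nonempty,
so the infimum is a minimum). -/
noncomputable def minCost (K : ℕ) (c : ℕ × ℕ → ℝ) (R : Finset ℕ) : ℝ :=
  sInf {x : ℝ | ∃ P : Finset (ℕ × ℕ), IsHierPart K P R ∧ cost c P = x}

/-- The bottom-up dynamic program:
`F(0,a) = c(0,a)`, `F(l+1,a) = min(c(l+1,a), ∑_{i<K} F(l, K·a+i))`. -/
noncomputable def dpF (K : ℕ) (c : ℕ × ℕ → ℝ) : ℕ → ℕ → ℝ
  | 0, a => c (0, a)
  | l + 1, a => min (c (l + 1, a)) (∑ i ∈ Finset.range K, dpF K c l (K * a + i))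

theorem mem_kInt_iff {K : ℕ} (hK : 0 < K) {l a x : ℕ} :
    x ∈ kInt K l a ↔ x / K ^ l = a := by
  rw [kInt, Finset.mem_Ico, Nat.div_eq_iff (pow_pos hK l)]
  have h := pow_pos hK l
  rw [add_mul]
  omega

theorem left_mem_kInt {K : ℕ} (hK : 0 < K) (l a : ℕ) : a * K ^ l ∈ kInt K l a := by
  rw [mem_kInt_iff hK]
  exact Nat.mul_div_cancel _ (pow_pos hK l)

theorem card_kInt (K l a : ℕ) : (kInt K l a).card = K ^ l := by
  rw [kInt, Nat.card_Ico, add_mul, one_mul, Nat.add_sub_cancel_left]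

theorem mem_kInt_succ_iff {K : ℕ} (hK : 0 < K) {l a x : ℕ} :
    x ∈ kInt K (l + 1) a ↔ ∃ i < K, x ∈ kInt K l (K * a + i) := by
  simp only [mem_kInt_iff hK, pow_succ, ← Nat.div_div_eq_div_mul]
  constructor
  · rintro rfl
    exact ⟨_, Nat.mod_lt _ hK, (Nat.div_add_mod _ _).symm⟩
  · rintro ⟨i, hi, h⟩
    rw [h, Nat.mul_add_div hK, Nat.div_eq_of_lt hi, add_zero]

/-- Members of a finer interval share the ancestor at every coarser level. -/
theorem div_pow_of_mem_kInt {K : ℕ} (hK : 0 < K) {k l b x : ℕ} (hkl : k ≤ l)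
    (hx : x ∈ kInt K k b) : x / K ^ l = b / K ^ (l - k) := by
  rw [mem_kInt_iff hK] at hx
  rw [← hx, Nat.div_div_eq_div_mul, ← pow_add, Nat.add_sub_cancel' hkl]

theorem isHierPart_singleton (K l a : ℕ) : IsHierPart K {(l, a)} (kInt K l a) := by
  simp [IsHierPart]

namespace IsHierPart

variable {K : ℕ} {P : Finset (ℕ × ℕ)} {R : Finset ℕ}

theorem subset (h : IsHierPart K P R) {p : ℕ × ℕ} (hp : p ∈ P) : kInt K p.1 p.2 ⊆ R := by
  rw [← h.2]
  exact Finset.subset_biUnion_of_mem (fun p : ℕ × ℕ => kInt K p.1 p.2) hp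

theorem exists_mem (h : IsHierPart K P R) {x : ℕ} (hx : x ∈ R) :
    ∃ p ∈ P, x ∈ kInt K p.1 p.2 := by
  rwa [← h.2, Finset.mem_biUnion] at hx

theorem level_le (hK : 2 ≤ K) {l a : ℕ} (h : IsHierPart K P (kInt K l a)) {p : ℕ × ℕ}
    (hp : p ∈ P) : p.1 ≤ l := by
  have hc := Finset.card_le_card (h.subset hp)
  rw [card_kInt, card_kInt] at hc
  exact (Nat.pow_le_pow_iff_right hK).1 hc

theorem eq_of_level_eq (hK : 0 < K) {l a : ℕ} (h : IsHierPart K P (kInt K l a)) {p : ℕ × ℕ}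
    (hp : p ∈ P) (hl : p.1 = l) : p = (l, a) := by
  have hx := h.subset hp (left_mem_kInt hK _ _)
  rw [mem_kInt_iff hK, hl, Nat.mul_div_cancel _ (pow_pos hK l)] at hx
  exact Prod.ext hl hx

theorem eq_singleton (hK : 0 < K) {l a : ℕ} (h : IsHierPart K P (kInt K l a))
    (ha : (l, a) ∈ P) : P = {(l, a)} := by
  refine Finset.eq_singleton_iff_unique_mem.2 ⟨ha, fun p hp => ?_⟩
  by_contra hne
  have hx := left_mem_kInt hK p.1 p.2
  exact Finset.disjoint_left.1 (h.1 p hp _ ha hne) hx (h.subset hp hx)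

/-- Gluing hierarchical partitions of the children gives one of the parent. -/
theorem biUnion_children (hK : 0 < K) {l a : ℕ} {Q : ℕ → Finset (ℕ × ℕ)}
    (hQ : ∀ i, IsHierPart K (Q i) (kInt K l (K * a + i))) :
    IsHierPart K ((Finset.range K).biUnion Q) (kInt K (l + 1) a) := by
  constructor
  · intro p hp q hq hne
    obtain ⟨i, -, hp⟩ := Finset.mem_biUnion.1 hp
    obtain ⟨j, -, hq⟩ := Finset.mem_biUnion.1 hq
    by_cases hij : i = j
    · subst hij
      exact (hQ i).1 p hp q hq hne
    · refine Finset.disjoint_left.2 fun x hxp hxq => hij ?_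
      have h₁ := (mem_kInt_iff hK).1 ((hQ i).subset hp hxp)
      have h₂ := (mem_kInt_iff hK).1 ((hQ j).subset hq hxq)
      omega
  · ext x
    rw [Finset.biUnion_biUnion, Finset.mem_biUnion, mem_kInt_succ_iff hK]
    simp only [(hQ _).2, Finset.mem_range]

theorem cost_biUnion_children (hK : 0 < K) (c : ℕ × ℕ → ℝ) {l a : ℕ}
    {Q : ℕ → Finset (ℕ × ℕ)} (hQ : ∀ i, IsHierPart K (Q i) (kInt K l (K * a + i))) :
    cost c ((Finset.range K).biUnion Q) = ∑ i ∈ Finset.range K, cost c (Q i) := by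
  refine Finset.sum_biUnion fun i _ j _ hij => Finset.disjoint_left.2 fun p hi hj => hij ?_
  have hx := left_mem_kInt hK p.1 p.2
  have h₁ := (mem_kInt_iff hK).1 ((hQ i).subset hi hx)
  have h₂ := (mem_kInt_iff hK).1 ((hQ j).subset hj hx)
  omega

/-- A hierarchical partition of an interval other than the trivial one splits into
hierarchical partitions of the children. -/
theorem exists_children (hK : 2 ≤ K) {l a : ℕ} (h : IsHierPart K P (kInt K (l + 1) a))
    (ha : (l + 1, a) ∉ P) :
    ∃ Q : ℕ → Finset (ℕ × ℕ), (∀ i < K, IsHierPart K (Q i) (kInt K l (K * a + i))) ∧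
      ∀ c : ℕ × ℕ → ℝ, ∑ i ∈ Finset.range K, cost c (Q i) = cost c P := by
  have hK0 : 0 < K := by omega
  have hlevel : ∀ p ∈ P, p.1 ≤ l := fun p hp => by
    have hle := h.level_le hK hp
    have hne : p.1 ≠ l + 1 := fun hl => ha (h.eq_of_level_eq hK0 hp hl ▸ hp)
    omega
  let f : ℕ × ℕ → ℕ := fun p => p.2 / K ^ (l - p.1)
  have hmem : ∀ p ∈ P, ∀ x ∈ kInt K p.1 p.2, x ∈ kInt K l (f p) := fun p hp x hx =>
    (mem_kInt_iff hK0).2 (div_pow_of_mem_kInt hK0 (hlevel p hp) hx)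
  have hf : ∀ p ∈ P, f p = K * a + f p % K := fun p hp => by
    have hx := left_mem_kInt hK0 p.1 p.2
    obtain ⟨i, hi, hxi⟩ := (mem_kInt_succ_iff hK0).1 (h.subset hp hx)
    have hfp : f p = K * a + i :=
      ((mem_kInt_iff hK0).1 (hmem p hp _ hx)).symm.trans ((mem_kInt_iff hK0).1 hxi)
    rw [hfp, Nat.mul_add_mod, Nat.mod_eq_of_lt hi]
  refine ⟨fun i => P.filter fun p => f p % K = i, fun i hi => ⟨?_, ?_⟩, fun c => ?_⟩
  · intro p hp q hq
    exact h.1 p (Finset.mem_filter.1 hp).1 q (Finset.mem_filter.1 hq).1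
  · ext x
    simp only [Finset.mem_biUnion, Finset.mem_filter]
    constructor
    · rintro ⟨p, ⟨hp, rfl⟩, hx⟩
      rw [← hf p hp]
      exact hmem p hp x hx
    · intro hx
      obtain ⟨p, hp, hxp⟩ := h.exists_mem ((mem_kInt_succ_iff hK0).2 ⟨i, hi, hx⟩)
      refine ⟨p, ⟨hp, ?_⟩, hxp⟩
      have h₁ := (mem_kInt_iff hK0).1 (hmem p hp x hxp)
      have h₂ := (mem_kInt_iff hK0).1 hx
      have h₃ := hf p hp
      omega
  · exact Finset.sum_fiberwise_of_maps_to
      (fun p _ => Finset.mem_range.2 (Nat.mod_lt _ hK0)) c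

end IsHierPart

theorem exists_isHierPart_cost_eq_dpF {K : ℕ} (hK : 0 < K) (c : ℕ × ℕ → ℝ) (l a : ℕ) :
    ∃ P, IsHierPart K P (kInt K l a) ∧ cost c P = dpF K c l a := by
  induction l generalizing a with
  | zero => exact ⟨_, isHierPart_singleton K 0 a, by simp [cost, dpF]⟩
  | succ l ih =>
    rw [dpF]
    rcases min_choice (c (l + 1, a)) (∑ i ∈ Finset.range K, dpF K c l (K * a + i)) with h | h
    · exact ⟨_, isHierPart_singleton K (l + 1) a, by simp [cost, h]⟩
    · choose Q hQ hcost using fun i => ih (K * a + i)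
      refine ⟨_, IsHierPart.biUnion_children hK hQ, ?_⟩
      rw [IsHierPart.cost_biUnion_children hK c hQ, h]
      exact Finset.sum_congr rfl fun i _ => hcost i

theorem dpF_le_cost {K : ℕ} (hK : 2 ≤ K) (c : ℕ × ℕ → ℝ) {l a : ℕ} {P : Finset (ℕ × ℕ)}
    (h : IsHierPart K P (kInt K l a)) : dpF K c l a ≤ cost c P := by
  have hK0 : 0 < K := by omega
  induction l generalizing a P with
  | zero =>
    obtain ⟨p, hp, -⟩ := h.exists_mem (left_mem_kInt hK0 0 a)
    have hpa := h.eq_of_level_eq hK0 hp (Nat.le_zero.1 (h.level_le hK hp))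
    rw [h.eq_singleton hK0 (hpa ▸ hp)]
    simp [cost, dpF]
  | succ l ih =>
    rw [dpF]
    by_cases ha : (l + 1, a) ∈ P
    · rw [h.eq_singleton hK0 ha]
      simp [cost]
    · obtain ⟨Q, hQ, hcost⟩ := h.exists_children hK ha
      rw [← hcost c]
      exact (min_le_right _ _).trans
        (Finset.sum_le_sum fun i hi => ih (hQ i (Finset.mem_range.1 hi)))

/-- Correctness of the dynamic program: for every hierarchical grid `I(l,a)`,
`F(l,a)` equals the minimum cost over all hierarchical partitions of `I(l,a)`. -/
theorem dpF_eq_minCost (K : ℕ) (hK : 2 ≤ K) (c : ℕ × ℕ → ℝ) (l a : ℕ) :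
    dpF K c l a = minCost K c (kInt K l a) := by
  have hleast : IsLeast {x : ℝ | ∃ P : Finset (ℕ × ℕ),
      IsHierPart K P (kInt K l a) ∧ cost c P = x} (dpF K c l a) := by
    refine ⟨exists_isHierPart_cost_eq_dpF (by omega) c l a, ?_⟩
    rintro x ⟨P, hP, rfl⟩
    exact dpF_le_cost hK c hP
  exact hleast.csInf_eq.symm
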